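/- arXiv:2305.17867 — 3 statements merged into one kernel-verified Lean document; each statement's English description precedes it below -/
import Mathlib

section
/- The function h is strictly increasing: for r₁, r₂ ∈ {1, 2, …, N(p−c)} with r₁ < r₂, one has h(r₁) < h(r₂). -/
open scoped BigOperators

def Mfin (d t : ℕ) : Finset (Fin d → ℕ) :=
  (Fintype.piFinset fun _ : Fin d => Finset.range (t + 1)).filter fun q => ∑ i, q i ≤ t

def Nc (d t : ℕ) : ℕ := (Mfin d t).card

structure GradedOrdering (d : ℕ) where
  toEquiv : ℕ+ ≃ (Fin d → ℕ)
  map_one : toEquiv 1 = 0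
  graded : ∀ i j : ℕ+, (∑ k, toEquiv i k) < (∑ k, toEquiv j k) → i < j
  compat : ∀ i j k : ℕ+, i < j →
    toEquiv.symm (toEquiv i + toEquiv k) < toEquiv.symm (toEquiv j + toEquiv k)

open Classical in
noncomputable def bcoef {d : ℕ} (a : (Fin d → ℕ) → ℂ) (c : ℕ) (n m : Fin d → ℕ) : ℂ :=
  if n ≤ m ∧ m - n ∈ Mfin d c then a (m - n) else 0

noncomputable def hIdx {d : ℕ} (a : (Fin d → ℕ) → ℂ) (c p : ℕ) (ν : GradedOrdering d)
    (i : ℕ+) : ℕ+ :=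
  (sSup {l : ℕ | 0 < l ∧ l ≤ Nc d p ∧
    bcoef a c (ν.toEquiv i) (ν.toEquiv l.toPNat') ≠ 0}).toPNat'

def barSet {d : ℕ} (a : (Fin d → ℕ) → ℂ) (c p : ℕ) (ν : GradedOrdering d) : Set ℕ+ :=
  {l | ∃ i : ℕ+, (i : ℕ) ≤ Nc d (p - c) ∧ hIdx a c p ν i = l}

open Classical in
noncomputable def Jfin {d : ℕ} (a : (Fin d → ℕ) → ℂ) (c p : ℕ) (ν : GradedOrdering d) :
    Finset ℕ+ :=
  ((Finset.range (Nc d p)).filter fun l => l.succPNat ∉ barSet a c p ν).image Nat.succPNat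

noncomputable def Pbar {d : ℕ} (a : (Fin d → ℕ) → ℂ) (c p : ℕ) (ν : GradedOrdering d) :
    Matrix (Fin (Nc d (p - c))) (Fin (Nc d (p - c))) ℂ :=
  Matrix.of fun i j =>
    bcoef a c (ν.toEquiv i.val.succPNat) (ν.toEquiv (hIdx a c p ν j.val.succPNat))

open Classical in
noncomputable def Mdec {d : ℕ} (a : (Fin d → ℕ) → ℂ) (c p : ℕ) (ν : GradedOrdering d)
    (i s : ℕ+) : ℂ :=
  if hr : ∃ r : Fin (Nc d (p - c)), hIdx a c p ν r.val.succPNat = i then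
    -∑ r₂ : Fin (Nc d (p - c)), (Pbar a c p ν)⁻¹ hr.choose r₂ *
      bcoef a c (ν.toEquiv r₂.val.succPNat) (ν.toEquiv s)
  else if i = s then (1 : ℂ) else 0

noncomputable def pderiv' {d : ℕ} (i : Fin d) (f : (Fin d → ℝ) → ℂ) : (Fin d → ℝ) → ℂ :=
  fun x => fderiv ℝ f x (Pi.single i 1)

noncomputable def mderiv {d : ℕ} (m : Fin d → ℕ) (f : (Fin d → ℝ) → ℂ) :
    (Fin d → ℝ) → ℂ :=
  (List.finRange d).foldr (fun i g => (pderiv' i)^[m i] g) f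

open Classical in
noncomputable def Tmat {d : ℕ} (ν : GradedOrdering d) (hv : Fin d → ℝ) (n i : ℕ+) : ℂ :=
  if ν.toEquiv i ≤ ν.toEquiv n then
    ∏ k, (((hv k : ℝ) : ℂ) ^ ((ν.toEquiv n - ν.toEquiv i) k) /
      (((ν.toEquiv n - ν.toEquiv i) k).factorial : ℂ))
  else 0

noncomputable def alphaVec {d : ℕ} (ν : GradedOrdering d) (y c₁ : Fin d → ℝ) (n : ℕ+) : ℂ :=
  ∏ k, (((c₁ k - y k : ℝ) : ℂ) ^ (ν.toEquiv n k) / ((ν.toEquiv n k).factorial : ℂ))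

theorem mem_Mfin {d t : ℕ} {q : Fin d → ℕ} : q ∈ Mfin d t ↔ ∑ i, q i ≤ t := by
  simp only [Mfin, Finset.mem_filter, Fintype.mem_piFinset, Finset.mem_range,
    and_iff_right_iff_imp]
  intro h i
  exact Nat.lt_succ_of_le ((Finset.single_le_sum (fun j _ => Nat.zero_le (q j))
    (Finset.mem_univ i)).trans h)

/-- A graded ordering enumerates `Mfin d t` by the indices `1, …, Nc d t`. -/
theorem GradedOrdering.le_Nc_iff {d : ℕ} (ν : GradedOrdering d) (t : ℕ) (l : ℕ+) :
    (l : ℕ) ≤ Nc d t ↔ ∑ k, ν.toEquiv l k ≤ t := by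
  set S : Finset ℕ+ := (Mfin d t).map ν.toEquiv.symm.toEmbedding with hS
  have hcard : S.card = Nc d t := Finset.card_map _
  have hmem : ∀ j, j ∈ S ↔ ∑ k, ν.toEquiv j k ≤ t := fun j => by
    rw [hS, Finset.mem_map_equiv, Equiv.symm_symm, mem_Mfin]
  constructor
  · intro hl
    by_contra! hlt
    have hsub : S ⊆ Finset.Ico 1 l := fun j hj =>
      Finset.mem_Ico.2 ⟨one_le, ν.graded _ _ (((hmem j).1 hj).trans_lt hlt)⟩
    have hle := Finset.card_le_card hsub
    rw [hcard, PNat.card_Ico, PNat.one_coe] at hle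
    have := l.pos
    omega
  · intro hl
    have hsub : Finset.Icc 1 l ⊆ S := fun j hj => by
      rw [hmem]
      by_contra! hlt
      exact (ν.graded _ _ (hl.trans_lt hlt)).not_ge (Finset.mem_Icc.1 hj).2
    have hle := Finset.card_le_card hsub
    rw [hcard, PNat.card_Icc, PNat.one_coe] at hle
    omega

theorem bcoef_add_right {d : ℕ} (a : (Fin d → ℕ) → ℂ) {c : ℕ} (n : Fin d → ℕ)
    {q : Fin d → ℕ} (hq : q ∈ Mfin d c) : bcoef a c n (q + n) = a q := by
  rw [bcoef, add_tsub_cancel_right, if_pos ⟨le_add_self, hq⟩]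

theorem exists_of_bcoef_ne_zero {d : ℕ} {a : (Fin d → ℕ) → ℂ} {c : ℕ} {n m : Fin d → ℕ}
    (h : bcoef a c n m ≠ 0) : ∃ q ∈ Mfin d c, m = q + n ∧ a q ≠ 0 := by
  rw [bcoef] at h
  split_ifs at h with hm
  · exact ⟨m - n, hm.2, (tsub_add_cancel_of_le hm.1).symm, h⟩
  · exact absurd rfl h

theorem isGreatest_hIdx {d : ℕ} (a : (Fin d → ℕ) → ℂ) (c p : ℕ) (ν : GradedOrdering d) (i : ℕ+)
    (hne : {l : ℕ+ | (l : ℕ) ≤ Nc d p ∧ bcoef a c (ν.toEquiv i) (ν.toEquiv l) ≠ 0}.Nonempty) :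
    IsGreatest {l : ℕ+ | (l : ℕ) ≤ Nc d p ∧ bcoef a c (ν.toEquiv i) (ν.toEquiv l) ≠ 0}
      (hIdx a c p ν i) := by
  set B : Set ℕ := {l : ℕ | 0 < l ∧ l ≤ Nc d p ∧
    bcoef a c (ν.toEquiv i) (ν.toEquiv l.toPNat') ≠ 0}
  have hmemB : ∀ l : ℕ+, (l : ℕ) ≤ Nc d p ∧ bcoef a c (ν.toEquiv i) (ν.toEquiv l) ≠ 0 →
      (l : ℕ) ∈ B := fun l hl => ⟨l.pos, hl.1, by rw [PNat.coe_toPNat']; exact hl.2⟩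
  have hbdd : BddAbove B := ⟨Nc d p, fun l hl => hl.2.1⟩
  obtain ⟨l₀, hl₀⟩ := hne
  have hsup : sSup B ∈ B := Nat.sSup_mem ⟨l₀, hmemB l₀ hl₀⟩ hbdd
  have hcoe : (hIdx a c p ν i : ℕ) = sSup B := PNat.toPNat'_coe hsup.1
  refine ⟨⟨hcoe.trans_le hsup.2.1, hsup.2.2⟩, fun l hl => ?_⟩
  rw [← PNat.coe_le_coe, hcoe]
  exact le_csSup hbdd (hmemB l hl)

/-- Multiplying the monomial of index `i` by a monomial in the support of `a` gives an index of a
nonzero entry in row `i`. -/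
theorem symm_add_mem_row {d p c : ℕ} (hpc : c ≤ p) (ν : GradedOrdering d) {a : (Fin d → ℕ) → ℂ}
    {i : ℕ+} (hi : (i : ℕ) ≤ Nc d (p - c)) {q : Fin d → ℕ} (hq : q ∈ Mfin d c) (haq : a q ≠ 0) :
    ν.toEquiv.symm (q + ν.toEquiv i) ∈
      {l : ℕ+ | (l : ℕ) ≤ Nc d p ∧ bcoef a c (ν.toEquiv i) (ν.toEquiv l) ≠ 0} := by
  rw [Set.mem_ofPred_eq, ν.le_Nc_iff, Equiv.apply_symm_apply, bcoef_add_right a _ hq]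
  refine ⟨?_, haq⟩
  rw [ν.le_Nc_iff] at hi
  rw [mem_Mfin] at hq
  simp only [Pi.add_apply, Finset.sum_add_distrib]
  omega

/-- The function `h` is strictly increasing on `{1,…,N(p−c)}`. -/
theorem h_strictMono {d p c : ℕ} (hd : 1 ≤ d) (hc : 1 ≤ c) (hpc : c ≤ p)
    (ν : GradedOrdering d) (a : (Fin d → ℕ) → ℂ)
    (ha : ∃ m ∈ Mfin d c, (∑ i, m i) = c ∧ a m ≠ 0) :
    ∀ r₁ r₂ : ℕ+, (r₁ : ℕ) ≤ Nc d (p - c) → (r₂ : ℕ) ≤ Nc d (p - c) → r₁ < r₂ →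
      hIdx a c p ν r₁ < hIdx a c p ν r₂ := by
  intro r₁ r₂ h₁ h₂ hlt
  obtain ⟨m, hm, -, ham⟩ := ha
  have hg₁ := isGreatest_hIdx a c p ν r₁ ⟨_, symm_add_mem_row hpc ν h₁ hm ham⟩
  have hg₂ := isGreatest_hIdx a c p ν r₂ ⟨_, symm_add_mem_row hpc ν h₂ hm ham⟩
  obtain ⟨q, hq, hqe, haq⟩ := exists_of_bcoef_ne_zero hg₁.1.2
  calc hIdx a c p ν r₁ = ν.toEquiv.symm (q + ν.toEquiv r₁) := by
        rw [← hqe, Equiv.symm_apply_apply]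
    _ < ν.toEquiv.symm (q + ν.toEquiv r₂) := by
        simpa [add_comm] using ν.compat r₁ r₂ (ν.toEquiv.symm q) hlt
    _ ≤ hIdx a c p ν r₂ := hg₂.2 (symm_add_mem_row hpc ν h₂ hq haq)
end

section
/- There exist complex coefficients v_{k,s}, defined for k ∈ M(p) and represented indices s ∈ j with |ν(s)| ≤ |k| and depending only on the coefficients a, the order p, and the ordering ν, such that for every vector w ∈ ℂ^{N(p)} with P w = 0 and every k ∈ M(p): w_{ν⁻¹(k)} = Σ_{s ∈ j, |ν(s)| ≤ |k|} v_{k,s} · w_s. -/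
open scoped BigOperators

theorem PNat.mem_iff_le_card_of_lower {S : Finset ℕ+}
    (hS : ∀ x ∈ S, ∀ y ≤ x, y ∈ S) (x : ℕ+) : x ∈ S ↔ (x : ℕ) ≤ S.card := by
  constructor
  · intro hx
    have hsub : Finset.Icc 1 x ⊆ S := fun y hy => hS x hx y (Finset.mem_Icc.1 hy).2
    simpa using Finset.card_le_card hsub
  · intro hx
    by_contra hxS
    have hsub : S ⊆ Finset.Ico 1 x := fun y hy =>
      Finset.mem_Ico.2 ⟨one_le, lt_of_not_ge fun h => hxS (hS y hy x h)⟩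
    have hcard := Finset.card_le_card hsub
    rw [PNat.card_Ico] at hcard
    have hpos := x.pos
    simp only [PNat.one_coe] at hcard
    omega

namespace GradedOrdering

variable {d : ℕ} (ν : GradedOrdering d)

theorem degree_mono {i j : ℕ+} (h : i ≤ j) : ∑ k, ν.toEquiv i k ≤ ∑ k, ν.toEquiv j k :=
  le_of_not_gt fun hlt => absurd (ν.graded j i hlt) (not_lt.2 h)

theorem le_Nc_iff_s12 (t : ℕ) (l : ℕ+) : (l : ℕ) ≤ Nc d t ↔ ∑ k, ν.toEquiv l k ≤ t := by
  have hmem : ∀ x, x ∈ (Mfin d t).map ν.toEquiv.symm.toEmbedding ↔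
      ∑ k, ν.toEquiv x k ≤ t := fun x => by
    rw [Finset.mem_map_equiv, Equiv.symm_symm, mem_Mfin]
  have h := PNat.mem_iff_le_card_of_lower
    (S := (Mfin d t).map ν.toEquiv.symm.toEmbedding)
    (fun x hx y hy => (hmem y).2 ((ν.degree_mono hy).trans ((hmem x).1 hx))) l
  rw [Finset.card_map, hmem] at h
  exact h.symm

end GradedOrdering

theorem mem_Jfin {d : ℕ} {a : (Fin d → ℕ) → ℂ} {c p : ℕ} {ν : GradedOrdering d} {l : ℕ+} :
    l ∈ Jfin a c p ν ↔ (l : ℕ) ≤ Nc d p ∧ l ∉ barSet a c p ν := by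
  simp only [Jfin, Finset.mem_image, Finset.mem_filter, Finset.mem_range]
  constructor
  · rintro ⟨n, ⟨hn, hbar⟩, rfl⟩
    exact ⟨hn, hbar⟩
  · rintro ⟨hl, hbar⟩
    refine ⟨l.natPred, ?_, PNat.succPNat_natPred l⟩
    rw [PNat.succPNat_natPred]
    exact ⟨by have := PNat.natPred_add_one l; omega, hbar⟩

/-- In an admissible row `i`, the index `hIdx i` is attained: it is the position of the last
nonzero coefficient. -/
theorem hIdx_spec {d p c : ℕ} (hpc : c ≤ p) (ν : GradedOrdering d) (a : (Fin d → ℕ) → ℂ)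
    (ha : ∃ m ∈ Mfin d c, (∑ i, m i) = c ∧ a m ≠ 0) {i : ℕ+} (hi : (i : ℕ) ≤ Nc d (p - c)) :
    (hIdx a c p ν i : ℕ) ≤ Nc d p ∧
      bcoef a c (ν.toEquiv i) (ν.toEquiv (hIdx a c p ν i)) ≠ 0 ∧
      ∀ l : ℕ+, (l : ℕ) ≤ Nc d p → hIdx a c p ν i < l →
        bcoef a c (ν.toEquiv i) (ν.toEquiv l) = 0 := by
  set S : Set ℕ := {l : ℕ | 0 < l ∧ l ≤ Nc d p ∧
    bcoef a c (ν.toEquiv i) (ν.toEquiv l.toPNat') ≠ 0} with hS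
  have hbdd : BddAbove S := ⟨Nc d p, fun l hl => hl.2.1⟩
  have hne : S.Nonempty := by
    obtain ⟨m, hm, -, ham⟩ := ha
    refine ⟨ν.toEquiv.symm (ν.toEquiv i + m), PNat.pos _, ?_, ?_⟩
    · rw [ν.le_Nc_iff_s12] at hi ⊢
      rw [mem_Mfin] at hm
      simp only [Equiv.apply_symm_apply, Pi.add_apply, Finset.sum_add_distrib]
      omega
    · rw [PNat.coe_toPNat', Equiv.apply_symm_apply, bcoef, add_tsub_cancel_left,
        if_pos ⟨le_self_add, hm⟩]
      exact ham
  have hmem : sSup S ∈ S := Nat.sSup_mem hne hbdd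
  have hval : (hIdx a c p ν i : ℕ) = sSup S := by
    simp only [hIdx, ← hS, Nat.toPNat'_coe, if_pos hmem.1]
  refine ⟨hval ▸ hmem.2.1, hmem.2.2, fun l hl hlt => ?_⟩
  by_contra hb
  have hle : (l : ℕ) ≤ sSup S := le_csSup hbdd ⟨l.pos, hl, by rwa [PNat.coe_toPNat']⟩
  rw [← hval] at hle
  exact absurd hlt (not_lt.2 hle)

/-- Solving a row of the system `P w = 0` for its last nonzero entry. -/
theorem eq_sum_of_row_eq_zero {N : ℕ} {b w : ℕ+ → ℂ} {l : ℕ+} (hl : (l : ℕ) ≤ N)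
    (hb : b l ≠ 0) (hlast : ∀ n : ℕ+, (n : ℕ) ≤ N → l < n → b n = 0)
    (hrow : ∑ n ∈ Finset.range N, b n.succPNat * w n.succPNat = 0) :
    w l = ∑ n ∈ Finset.range l.natPred, -(b n.succPNat / b l) * w n.succPNat := by
  have hlpred := PNat.natPred_add_one l
  have htrunc : ∑ n ∈ Finset.range (l.natPred + 1), b n.succPNat * w n.succPNat = 0 := by
    rw [← hrow]
    refine Finset.sum_subset (Finset.range_subset_range.2 (by omega)) fun n hn hn' => ?_
    rw [Finset.mem_range] at hn hn'
    rw [hlast n.succPNat hn (by rw [← PNat.coe_lt_coe, Nat.succPNat_coe]; omega), zero_mul]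
  rw [Finset.sum_range_succ, PNat.succPNat_natPred] at htrunc
  have hsum : ∑ n ∈ Finset.range l.natPred, -(b n.succPNat / b l) * w n.succPNat =
      -(∑ n ∈ Finset.range l.natPred, b n.succPNat * w n.succPNat) / b l := by
    rw [← Finset.sum_neg_distrib, Finset.sum_div]
    exact Finset.sum_congr rfl fun n _ => by ring
  rw [hsum, eq_div_iff hb]
  linear_combination htrunc

/-- Each entry of a solution of `P w = 0` is a combination of represented entries, with
coefficients that vanish at entries of higher degree. -/
theorem exists_representation {d p c : ℕ} (hpc : c ≤ p) (ν : GradedOrdering d)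
    (a : (Fin d → ℕ) → ℂ) (ha : ∃ m ∈ Mfin d c, (∑ i, m i) = c ∧ a m ≠ 0) (l : ℕ+) :
    ∃ u : ℕ+ → ℂ, (∀ s, u s ≠ 0 → ∑ i, ν.toEquiv s i ≤ ∑ i, ν.toEquiv l i) ∧
      ((l : ℕ) ≤ Nc d p → ∀ w : ℕ+ → ℂ,
        (∀ i : ℕ+, (i : ℕ) ≤ Nc d (p - c) →
          ∑ l ∈ Finset.range (Nc d p),
            bcoef a c (ν.toEquiv i) (ν.toEquiv l.succPNat) * w l.succPNat = 0) →
        w l = ∑ s ∈ Jfin a c p ν, u s * w s) := by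
  induction l using PNat.strongInductionOn with
  | _ l ih =>
  by_cases hbar : l ∈ barSet a c p ν
  · obtain ⟨i, hi, rfl⟩ := hbar
    obtain ⟨hle, hb, hlast⟩ := hIdx_spec hpc ν a ha hi
    set l := hIdx a c p ν i
    choose! u hu hrep using ih
    have hlt : ∀ n ∈ Finset.range l.natPred, n.succPNat < l := fun n hn => by
      have := PNat.natPred_add_one l
      rw [Finset.mem_range] at hn
      rw [← PNat.coe_lt_coe, Nat.succPNat_coe]
      omega
    refine ⟨fun s => ∑ n ∈ Finset.range l.natPred,
      -(bcoef a c (ν.toEquiv i) (ν.toEquiv n.succPNat) /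
        bcoef a c (ν.toEquiv i) (ν.toEquiv l)) * u n.succPNat s, fun s hs => ?_,
      fun _ w hw => ?_⟩
    · obtain ⟨n, hn, hne⟩ := Finset.exists_ne_zero_of_sum_ne_zero hs
      exact (hu _ (hlt n hn) s (right_ne_zero_of_mul hne)).trans
        (ν.degree_mono (hlt n hn).le)
    · rw [eq_sum_of_row_eq_zero (b := fun n => bcoef a c (ν.toEquiv i) (ν.toEquiv n))
        hle hb hlast (hw i hi)]
      simp only [Finset.sum_mul]
      rw [Finset.sum_comm]
      refine Finset.sum_congr rfl fun n hn => ?_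
      have hnN : (n.succPNat : ℕ) ≤ Nc d p := (PNat.coe_lt_coe _ _ |>.2 (hlt n hn)).le.trans hle
      rw [hrep _ (hlt n hn) hnN w hw, Finset.mul_sum]
      exact Finset.sum_congr rfl fun s _ => by ring
  · refine ⟨Pi.single l 1, fun s hs => ?_, fun hl w _ => ?_⟩
    · rw [Pi.single_apply, ne_eq, ite_eq_right_iff, Classical.not_imp] at hs
      rw [hs.1]
    · simp [Pi.single_apply, mem_Jfin, hl, hbar]

/-- There exist complex coefficients `v_{k,s}` (for `k ∈ M(p)` and
represented indices `s ∈ j` with `|ν(s)| ≤ |k|`), depending only on `a`, `p` and `ν`,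
such that every vector `w ∈ ℂ^{N(p)}` with `P w = 0` satisfies
`w_{ν⁻¹(k)} = ∑_{s ∈ j, |ν(s)| ≤ |k|} v_{k,s} w_s` for every `k ∈ M(p)`. -/
theorem deriv_less_order {d p c : ℕ} (hd : 1 ≤ d) (hc : 1 ≤ c) (hpc : c ≤ p)
    (ν : GradedOrdering d) (a : (Fin d → ℕ) → ℂ)
    (ha : ∃ m ∈ Mfin d c, (∑ i, m i) = c ∧ a m ≠ 0) :
    ∃ v : (Fin d → ℕ) → ℕ+ → ℂ,
      ∀ w : ℕ+ → ℂ,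
        (∀ i : ℕ+, (i : ℕ) ≤ Nc d (p - c) →
          ∑ l ∈ Finset.range (Nc d p),
            bcoef a c (ν.toEquiv i) (ν.toEquiv l.succPNat) * w l.succPNat = 0) →
        ∀ k ∈ Mfin d p,
          w (ν.toEquiv.symm k) =
            ∑ s ∈ (Jfin a c p ν).filter (fun s => (∑ i, ν.toEquiv s i) ≤ ∑ i, k i),
              v k s * w s := by
  choose u hu hrep using exists_representation hpc ν a ha
  refine ⟨fun k => u (ν.toEquiv.symm k), fun w hw k hk => ?_⟩
  rw [mem_Mfin] at hk
  rw [hrep _ ((ν.le_Nc_iff_s12 p _).2 (by rwa [Equiv.apply_symm_apply])) w hw]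
  refine (Finset.sum_filter_of_ne fun s _ hs => ?_).symm
  simpa using hu _ s (left_ne_zero_of_mul hs)
end

section
/- Let u(x,y) = (x² + y²) · log √(x² + y²), defined on ℝ² ∖ {(0,0)}. Then for all integers n ≥ 5 and m ≥ 2 and every (x,y) ≠ (0,0): (x² + y²) · ∂^{n+m}u/∂xⁿ∂yᵐ = −2(n−2)·x · ∂^{n+m−1}u/∂x^{n−1}∂yᵐ − (n−1)(n−4) · ∂^{n+m−2}u/∂x^{n−2}∂yᵐ − 2m·y · ∂^{n+m−1}u/∂xⁿ∂y^{m−1} − m(m−1) · ∂^{n+m−2}u/∂xⁿ∂y^{m−2}. -/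
/-- Partial derivative with respect to the first variable. -/
noncomputable def dX (f : ℝ → ℝ → ℝ) : ℝ → ℝ → ℝ := fun x y => deriv (fun s => f s y) x

/-- Partial derivative with respect to the second variable. -/
noncomputable def dY (f : ℝ → ℝ → ℝ) : ℝ → ℝ → ℝ := fun x y => deriv (fun s => f x s) y

/-- The 2D biharmonic kernel `u(x,y) = (x² + y²) log √(x² + y²)`. -/
noncomputable def uBih2 : ℝ → ℝ → ℝ :=
  fun x y => (x ^ 2 + y ^ 2) * Real.log (Real.sqrt (x ^ 2 + y ^ 2))

open scoped ContDiff Topology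

section OneVariable

variable {f : ℝ → ℝ} {x : ℝ}

theorem iteratedDeriv_id_mul (k : ℕ) (hf : ContDiffAt ℝ ∞ f x) :
    iteratedDeriv (k + 1) (fun s => s * f s) x =
      x * iteratedDeriv (k + 1) f x + (k + 1) * iteratedDeriv k f x := by
  rw [iteratedDeriv_fun_mul (by fun_prop) (hf.of_le (by exact_mod_cast le_top)),
    Finset.sum_range_succ', Finset.sum_range_succ', Finset.sum_eq_zero]
  · simp [iteratedDeriv_fun_id]
    ring
  · intro i _
    simp [iteratedDeriv_fun_id]

theorem iteratedDeriv_sq_add_const_mul (c : ℝ) (k : ℕ) (hf : ContDiffAt ℝ ∞ f x) :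
    iteratedDeriv (k + 2) (fun s => (s ^ 2 + c) * f s) x =
      (x ^ 2 + c) * iteratedDeriv (k + 2) f x + 2 * (k + 2) * x * iteratedDeriv (k + 1) f x
        + (k + 2) * (k + 1) * iteratedDeriv k f x := by
  have hsplit : (fun s => (s ^ 2 + c) * f s) = fun s => s * (s * f s) + c * f s := by
    ext s
    ring
  have hf' : ContDiffAt ℝ ((k + 2 : ℕ) : ℕ∞) f x := hf.of_le (mod_cast le_top)
  rw [hsplit, iteratedDeriv_fun_add (by fun_prop) (by fun_prop),
    iteratedDeriv_id_mul _ (contDiffAt_fun_id.mul hf), iteratedDeriv_const_mul_field,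
    iteratedDeriv_id_mul (k + 1) hf, iteratedDeriv_id_mul k hf]
  push_cast
  ring

end OneVariable

/-- Smoothness on the punctured plane. -/
def SmoothOffOrigin (f : ℝ → ℝ → ℝ) : Prop :=
  ∀ x y : ℝ, (x, y) ≠ (0, 0) → ContDiffAt ℝ ∞ (Function.uncurry f) (x, y)

/-- Equality on the punctured plane. -/
def EqOffOrigin (f g : ℝ → ℝ → ℝ) : Prop :=
  ∀ x y : ℝ, (x, y) ≠ (0, 0) → f x y = g x y

theorem dX_iterate_apply (f : ℝ → ℝ → ℝ) (n : ℕ) (x y : ℝ) :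
    dX^[n] f x y = iteratedDeriv n (fun s => f s y) x := by
  induction n generalizing f with
  | zero => simp
  | succ n ih =>
    rw [Function.iterate_succ_apply, ih, iteratedDeriv_succ']
    rfl

theorem dY_iterate_apply (f : ℝ → ℝ → ℝ) (n : ℕ) (x y : ℝ) :
    dY^[n] f x y = iteratedDeriv n (fun s => f x s) y := by
  induction n generalizing f with
  | zero => simp
  | succ n ih =>
    rw [Function.iterate_succ_apply, ih, iteratedDeriv_succ']
    rfl

theorem eventually_ne_origin_fst {x y : ℝ} (h : (x, y) ≠ (0, 0)) :
    ∀ᶠ s in 𝓝 x, (s, y) ≠ (0, 0) :=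
  (Continuous.prodMk_left y).continuousAt.eventually_ne h

theorem eventually_ne_origin_snd {x y : ℝ} (h : (x, y) ≠ (0, 0)) :
    ∀ᶠ s in 𝓝 y, (x, s) ≠ (0, 0) :=
  (Continuous.prodMk_right x).continuousAt.eventually_ne h

namespace EqOffOrigin

variable {f g : ℝ → ℝ → ℝ}

theorem dX_iterate (h : EqOffOrigin f g) (n : ℕ) : EqOffOrigin (dX^[n] f) (dX^[n] g) := by
  intro x y hxy
  rw [dX_iterate_apply, dX_iterate_apply]
  exact Filter.EventuallyEq.iteratedDeriv_eq n
    ((eventually_ne_origin_fst hxy).mono fun s hs => h s y hs)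

theorem dY_iterate (h : EqOffOrigin f g) (n : ℕ) : EqOffOrigin (dY^[n] f) (dY^[n] g) := by
  intro x y hxy
  rw [dY_iterate_apply, dY_iterate_apply]
  exact Filter.EventuallyEq.iteratedDeriv_eq n
    ((eventually_ne_origin_snd hxy).mono fun s hs => h x s hs)

end EqOffOrigin

theorem dX_eq_fderiv {f : ℝ → ℝ → ℝ} {x y : ℝ}
    (hf : DifferentiableAt ℝ (Function.uncurry f) (x, y)) :
    dX f x y = fderiv ℝ (Function.uncurry f) (x, y) (1, 0) :=
  (hf.hasFDerivAt.comp_hasDerivAt (f := fun s => (s, y)) x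
    ((hasDerivAt_id x).prodMk (hasDerivAt_const x y))).deriv

theorem dY_eq_fderiv {f : ℝ → ℝ → ℝ} {x y : ℝ}
    (hf : DifferentiableAt ℝ (Function.uncurry f) (x, y)) :
    dY f x y = fderiv ℝ (Function.uncurry f) (x, y) (0, 1) :=
  (hf.hasFDerivAt.comp_hasDerivAt (f := fun s => (x, s)) y
    ((hasDerivAt_const y x).prodMk (hasDerivAt_id y))).deriv

namespace SmoothOffOrigin

variable {f : ℝ → ℝ → ℝ} {x y : ℝ}

theorem contDiffAt_fst (hf : SmoothOffOrigin f) (h : (x, y) ≠ (0, 0)) :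
    ContDiffAt ℝ ∞ (fun s => f s y) x :=
  (hf x y h).comp x (contDiffAt_id.prodMk contDiffAt_const)

theorem contDiffAt_snd (hf : SmoothOffOrigin f) (h : (x, y) ≠ (0, 0)) :
    ContDiffAt ℝ ∞ (fun s => f x s) y :=
  (hf x y h).comp y (contDiffAt_const.prodMk contDiffAt_id)

theorem uncurry_dX_eventuallyEq (hf : SmoothOffOrigin f) (h : (x, y) ≠ (0, 0)) :
    Function.uncurry (dX f) =ᶠ[𝓝 (x, y)]
      fun p => fderiv ℝ (Function.uncurry f) p (1, 0) :=
  (continuousAt_id.eventually_ne h).mono fun p hp =>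
    dX_eq_fderiv ((hf p.1 p.2 hp).differentiableAt (by simp))

theorem uncurry_dY_eventuallyEq (hf : SmoothOffOrigin f) (h : (x, y) ≠ (0, 0)) :
    Function.uncurry (dY f) =ᶠ[𝓝 (x, y)]
      fun p => fderiv ℝ (Function.uncurry f) p (0, 1) :=
  (continuousAt_id.eventually_ne h).mono fun p hp =>
    dY_eq_fderiv ((hf p.1 p.2 hp).differentiableAt (by simp))

protected theorem dX (hf : SmoothOffOrigin f) : SmoothOffOrigin (dX f) := fun x y h =>
  (((hf x y h).fderiv_right (m := ∞) (by simp)).clm_apply contDiffAt_const).congr_of_eventuallyEq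
    (hf.uncurry_dX_eventuallyEq h)

protected theorem dY (hf : SmoothOffOrigin f) : SmoothOffOrigin (dY f) := fun x y h =>
  (((hf x y h).fderiv_right (m := ∞) (by simp)).clm_apply contDiffAt_const).congr_of_eventuallyEq
    (hf.uncurry_dY_eventuallyEq h)

theorem dY_iterate (hf : SmoothOffOrigin f) (m : ℕ) : SmoothOffOrigin (dY^[m] f) := by
  induction m generalizing f with
  | zero => exact hf
  | succ m ih => exact ih hf.dY

theorem dY_dX (hf : SmoothOffOrigin f) :
    EqOffOrigin (dY (dX f)) (dX (dY f)) := by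
  intro x y h
  have hd : DifferentiableAt ℝ (fderiv ℝ (Function.uncurry f)) (x, y) :=
    ((hf x y h).fderiv_right (m := ∞) (by simp)).differentiableAt (by simp)
  have happly (v : ℝ × ℝ) : HasFDerivAt (fun p => fderiv ℝ (Function.uncurry f) p v)
      ((fderiv ℝ (fderiv ℝ (Function.uncurry f)) (x, y)).flip v) (x, y) := by
    simpa using hd.hasFDerivAt.clm_apply (hasFDerivAt_const v (x, y))
  rw [dY_eq_fderiv ((hf.dX x y h).differentiableAt (by simp)),
    dX_eq_fderiv ((hf.dY x y h).differentiableAt (by simp)),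
    (hf.uncurry_dX_eventuallyEq h).fderiv_eq, (hf.uncurry_dY_eventuallyEq h).fderiv_eq,
    (happly _).fderiv, (happly _).fderiv]
  exact (hf x y h).isSymmSndFDerivAt
    (by simpa using WithTop.coe_le_coe.2 (le_top : (2 : ℕ∞) ≤ ⊤)) _ _

theorem dY_iterate_dX (hf : SmoothOffOrigin f) (m : ℕ) :
    EqOffOrigin (dY^[m] (dX f)) (dX (dY^[m] f)) := by
  induction m generalizing f with
  | zero => exact fun _ _ _ => rfl
  | succ m ih => exact fun x y h => (hf.dY_dX.dY_iterate m x y h).trans (ih hf.dY x y h)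

end SmoothOffOrigin

theorem sq_add_sq_pos_of_ne_origin {x y : ℝ} (h : (x, y) ≠ (0, 0)) : 0 < x ^ 2 + y ^ 2 := by
  rcases eq_or_ne x 0 with rfl | hx
  · have hy : y ≠ 0 := fun hy => h (by rw [hy])
    positivity
  · positivity

theorem smoothOffOrigin_uBih2 : SmoothOffOrigin uBih2 := by
  intro x y h
  have hpos := sq_add_sq_pos_of_ne_origin h
  have hr : ContDiffAt ℝ ∞ (fun p : ℝ × ℝ => p.1 ^ 2 + p.2 ^ 2) (x, y) := by fun_prop
  exact hr.mul ((hr.sqrt hpos.ne').log (Real.sqrt_pos.2 hpos).ne')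

theorem sq_add_sq_mul_dX_uBih2 : EqOffOrigin (fun x y => (y ^ 2 + x ^ 2) * dX uBih2 x y)
    (fun x y => 2 * x * uBih2 x y + (x ^ 3 + x * y ^ 2)) := by
  intro x y h
  have hpos := sq_add_sq_pos_of_ne_origin h
  have hr : HasDerivAt (fun s : ℝ => s ^ 2 + y ^ 2) (2 * x) x := by
    simpa using (hasDerivAt_pow 2 x).add_const (y ^ 2)
  have hu : dX uBih2 x y = 2 * x * Real.log √(x ^ 2 + y ^ 2) + x := by
    refine (hr.mul ((hr.sqrt hpos.ne').log (Real.sqrt_pos.2 hpos).ne')).deriv.trans ?_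
    have hs := Real.sq_sqrt hpos.le
    have hs' := (Real.sqrt_pos.2 hpos).ne'
    field_simp
    rw [hs]
    ring
  simp only [hu, uBih2]
  ring

theorem exists_iteratedDeriv_quadratic (j : ℕ) : ∃ c : ℝ, ∀ a b y : ℝ,
    iteratedDeriv (j + 2) (fun s => a + b * s ^ 2) y = c * b := by
  refine ⟨(2 : ℕ).descFactorial (j + 2), fun a b y => ?_⟩
  rw [iteratedDeriv_const_add (by lia), iteratedDeriv_const_mul_field, iteratedDeriv_pow]
  simp [mul_comm]

theorem dY_iterate_uBih2_relation (j : ℕ) : ∃ c : ℝ, EqOffOrigin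
    (fun x y => (x ^ 2 + y ^ 2) * dX (dY^[j + 2] uBih2) x y
      + (2 * (j + 2) * y * dX (dY^[j + 1] uBih2) x y
        + (j + 2) * (j + 1) * dX (dY^[j] uBih2) x y))
    (fun x y => 2 * (x * (dY^[j + 2] uBih2) x y) + c * x) := by
  obtain ⟨c, hc⟩ := exists_iteratedDeriv_quadratic j
  refine ⟨c, fun x y h => ?_⟩
  have hu := smoothOffOrigin_uBih2
  have hcomm (i : ℕ) : iteratedDeriv i (fun s => dX uBih2 x s) y = dX (dY^[i] uBih2) x y :=
    (dY_iterate_apply _ _ _ _).symm.trans (hu.dY_iterate_dX i x y h)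
  have hslice : ContDiffAt ℝ ((j + 2 : ℕ) : ℕ∞) (fun s => uBih2 x s) y :=
    (hu.contDiffAt_snd h).of_le (mod_cast le_top)
  have key := sq_add_sq_mul_dX_uBih2.dY_iterate (j + 2) x y h
  rw [dY_iterate_apply, dY_iterate_apply,
    iteratedDeriv_sq_add_const_mul (x ^ 2) j (hu.dX.contDiffAt_snd h),
    iteratedDeriv_fun_add (contDiffAt_const.mul hslice) (by fun_prop),
    iteratedDeriv_const_mul_field, hc, hcomm, hcomm, hcomm, ← dY_iterate_apply uBih2] at key
  linear_combination key

/-- Recurrence for the derivatives of `u = r² log r` (`r = √(x²+y²)`):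
for all `n ≥ 5`, `m ≥ 2` and `(x,y) ≠ (0,0)`,
`r² ∂^{n+m}u/∂xⁿ∂yᵐ = −2(n−2)x ∂/∂x^{n−1}∂yᵐ − (n−1)(n−4) ∂/∂x^{n−2}∂yᵐ
 − 2my ∂/∂xⁿ∂y^{m−1} − m(m−1) ∂/∂xⁿ∂y^{m−2}`. -/
theorem biharmonic2d_deriv_recurrence :
    ∀ n m : ℕ, 5 ≤ n → 2 ≤ m → ∀ x y : ℝ, (x, y) ≠ (0, 0) →
      (x ^ 2 + y ^ 2) * (dX^[n] (dY^[m] uBih2)) x y =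
        -(2 * ((n : ℝ) - 2) * x) * (dX^[n - 1] (dY^[m] uBih2)) x y
        - ((n : ℝ) - 1) * ((n : ℝ) - 4) * (dX^[n - 2] (dY^[m] uBih2)) x y
        - 2 * (m : ℝ) * y * (dX^[n] (dY^[m - 1] uBih2)) x y
        - (m : ℝ) * ((m : ℝ) - 1) * (dX^[n] (dY^[m - 2] uBih2)) x y := by
  intro n m hn hm x y h
  obtain ⟨k, rfl⟩ : ∃ k, n = k + 3 := ⟨n - 3, by lia⟩
  obtain ⟨j, rfl⟩ : ∃ j, m = j + 2 := ⟨m - 2, by lia⟩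
  obtain ⟨c, hc⟩ := dY_iterate_uBih2_relation j
  have hsmooth (i : ℕ) := smoothOffOrigin_uBih2.dY_iterate i
  have hslice (i : ℕ) : ContDiffAt ℝ ((k + 2 : ℕ) : ℕ∞) (fun s => (dY^[i] uBih2) s y) x :=
    ((hsmooth i).contDiffAt_fst h).of_le (mod_cast le_top)
  have hslice' (i : ℕ) : ContDiffAt ℝ ((k + 2 : ℕ) : ℕ∞) (fun s => dX (dY^[i] uBih2) s y) x :=
    ((hsmooth i).dX.contDiffAt_fst h).of_le (mod_cast le_top)
  have hiter (i l : ℕ) : iteratedDeriv l (fun s => dX (dY^[i] uBih2) s y) x =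
      (dX^[l + 1] (dY^[i] uBih2)) x y := (dX_iterate_apply _ _ _ _).symm
  have hlin : iteratedDeriv (k + 2) (fun s : ℝ => c * s) x = 0 := by
    rw [iteratedDeriv_const_mul_field c fun s => s, iteratedDeriv_fun_id]
    simp
  have key := hc.dX_iterate (k + 2) x y h
  rw [dX_iterate_apply, dX_iterate_apply,
    iteratedDeriv_fun_add ((by fun_prop : ContDiffAt ℝ _ _ x).mul (hslice' _))
      ((contDiffAt_const.mul (hslice' _)).add (contDiffAt_const.mul (hslice' _))),
    iteratedDeriv_fun_add (contDiffAt_const.mul (hslice' _)) (contDiffAt_const.mul (hslice' _)),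
    iteratedDeriv_sq_add_const_mul _ _ ((hsmooth _).dX.contDiffAt_fst h),
    iteratedDeriv_const_mul_field, iteratedDeriv_const_mul_field,
    iteratedDeriv_fun_add (contDiffAt_const.mul (contDiffAt_fun_id.mul (hslice _))) (by fun_prop),
    iteratedDeriv_const_mul_field, iteratedDeriv_id_mul _ ((hsmooth _).contDiffAt_fst h),
    hlin, hiter, hiter, hiter, hiter, hiter, ← dX_iterate_apply (dY^[j + 2] uBih2),
    ← dX_iterate_apply (dY^[j + 2] uBih2)] at key
  simp only [Nat.add_sub_cancel, show k + 3 - 1 = k + 2 by lia, show k + 3 - 2 = k + 1 by lia,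
    show j + 2 - 1 = j + 1 by lia]
  push_cast at key ⊢
  linear_combination key
end
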